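/- arXiv:2007.13581 — 2 statements merged into one kernel-verified Lean document; each statement's English description precedes it below -/
import Mathlib

section
/- Let 1 < α < 2. Then there exists a constant C > 0 such that for all λ > 0 and all t > 0, λ^{1/2} · t · |E_{α,2}(−λ t^α)| ≤ C t^{1−α/2}. -/
open Complex Real

/-- The Mittag–Leffler function `E_{α,β}(z) = Σ_{k=0}^∞ z^k / Γ(αk + β)`. -/
noncomputable def mittagLeffler (α β : ℝ) (z : ℂ) : ℂ :=
  ∑' k : ℕ, z ^ k / Complex.Gamma ((α * k + β : ℝ) : ℂ)

open MeasureTheory Set Filter Topology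

theorem differentiableAt_integral_rpow_mul_cexp {a : ℝ} (ha : 0 < a) {s : ℂ} (hs : 0 < s.re) :
    DifferentiableAt ℂ
      (fun s : ℂ ↦ ∫ t in Ioi (0 : ℝ), ((t ^ (a - 1) : ℝ) : ℂ) * cexp (-(s * t))) s := by
  have hmeas (b : ℝ) (z : ℂ) : AEStronglyMeasurable
      (fun t : ℝ ↦ ((t ^ b : ℝ) : ℂ) * cexp (-(z * t))) (volume.restrict (Ioi 0)) := by
    apply Measurable.aestronglyMeasurable
    fun_prop
  have hnorm (b : ℝ) (z : ℂ) {t : ℝ} (ht : 0 < t) :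
      ‖((t ^ b : ℝ) : ℂ) * cexp (-(z * t))‖ = t ^ b * rexp (-z.re * t) := by
    rw [norm_mul, Complex.norm_exp, norm_real, Real.norm_of_nonneg (by positivity)]
    simp
  have h_int {b r : ℝ} (hb : -1 < b) (hr : 0 < r) :
      IntegrableOn (fun t : ℝ ↦ t ^ b * rexp (-r * t)) (Ioi 0) := by
    simpa using integrableOn_rpow_mul_exp_neg_mul_rpow hb one_pos hr
  refine (hasDerivAt_integral_of_dominated_loc_of_deriv_le
    (s := {z : ℂ | s.re / 2 < z.re}) (bound := fun t ↦ t ^ a * rexp (-(s.re / 2) * t))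
    (F' := fun z t ↦ -(((t ^ a : ℝ) : ℂ) * cexp (-(z * t))))
    ((isOpen_lt continuous_const continuous_re).mem_nhds (by simp [hs]))
    (.of_forall fun z ↦ hmeas _ z) ?_ (hmeas _ s).neg ?_ (h_int (by linarith) (by linarith))
    ?_).2.differentiableAt
  · refine (h_int (b := a - 1) (by linarith) hs).mono' (hmeas _ s) ?_
    filter_upwards [ae_restrict_mem measurableSet_Ioi] with t ht
    exact (hnorm _ s ht).le
  · filter_upwards [ae_restrict_mem measurableSet_Ioi] with t ht z hz
    have ht' : 0 < t := ht
    have hz' : s.re / 2 < z.re := hz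
    rw [norm_neg, hnorm _ z ht]
    gcongr
  · filter_upwards [ae_restrict_mem measurableSet_Ioi] with t ht z hz
    have ht' : 0 < t := ht
    have h1 : HasDerivAt (fun z : ℂ ↦ -(z * t)) (-(t : ℂ)) z := by
      simpa only [id, one_mul] using! ((hasDerivAt_id z).mul_const (t : ℂ)).neg
    refine (h1.cexp.const_mul ((t ^ (a - 1) : ℝ) : ℂ)).congr_deriv ?_
    rw [show t ^ a = t ^ (a - 1) * t by rw [← rpow_add_one ht'.ne']; simp]
    push_cast
    ring

/-- Laplace transform of `t ^ (a - 1)` on the right half-plane. -/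
theorem integral_rpow_mul_cexp_Ioi {a : ℝ} (ha : 0 < a) {s : ℂ} (hs : 0 < s.re) :
    ∫ t in Ioi (0 : ℝ), ((t ^ (a - 1) : ℝ) : ℂ) * cexp (-(s * t))
      = s ^ (-a : ℂ) * Complex.Gamma a := by
  have hopen : IsOpen {z : ℂ | 0 < z.re} := isOpen_lt continuous_const continuous_re
  have hL : AnalyticOnNhd ℂ
      (fun s : ℂ ↦ ∫ t in Ioi (0 : ℝ), ((t ^ (a - 1) : ℝ) : ℂ) * cexp (-(s * t)))
      {z : ℂ | 0 < z.re} := DifferentiableOn.analyticOnNhd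
    (fun z hz ↦ (differentiableAt_integral_rpow_mul_cexp ha hz).differentiableWithinAt) hopen
  have hR : AnalyticOnNhd ℂ (fun s : ℂ ↦ s ^ (-a : ℂ) * Complex.Gamma a) {z : ℂ | 0 < z.re} :=
    DifferentiableOn.analyticOnNhd
      (fun z hz ↦ ((differentiableAt_id.cpow_const (.inl hz)).mul_const _).differentiableWithinAt)
      hopen
  refine hL.eqOn_of_preconnected_of_frequently_eq hR
    (convex_halfSpace_re_gt 0).isPreconnected (show (1 : ℂ) ∈ {z : ℂ | 0 < z.re} by simp) ?_ hs
  have htend : Tendsto (fun r : ℝ ↦ (r : ℂ)) (𝓝[>] 1) (𝓝[≠] 1) := by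
    refine tendsto_nhdsWithin_iff.2 ⟨?_, ?_⟩
    · exact (continuous_ofReal.tendsto' 1 1 (by simp)).mono_left nhdsWithin_le_nhds
    · filter_upwards [self_mem_nhdsWithin] with r hr
      simpa using! (ne_of_gt hr : r ≠ 1)
  refine htend.frequently (Eventually.frequently ?_)
  filter_upwards [self_mem_nhdsWithin] with r hr
  have hr0 : 0 < r := one_pos.trans hr
  have h := integral_cpow_mul_exp_neg_mul_Ioi (a := a) (by simpa using ha) hr0
  rw [cpow_neg, ← inv_cpow_ofReal_nonneg hr0.le, ← one_div, ← h]
  refine setIntegral_congr_fun measurableSet_Ioi fun t ht ↦ ?_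
  have ht' : (0 : ℝ) < t := ht
  simp only [ofReal_cpow ht'.le]
  push_cast
  rfl

theorem integrable_norm_add_mul_I_rpow {c p : ℝ} (hc : 0 < c) (hp : p < -1) :
    Integrable fun y : ℝ ↦ ‖(c + y * I : ℂ)‖ ^ p := by
  set m := min c 1 / 2 with hm
  have hm0 : 0 < m := by positivity
  have hne (y : ℝ) : (c + y * I : ℂ) ≠ 0 := fun h ↦ by simpa [hc.ne'] using congrArg re h
  refine ((integrable_one_add_norm (E := ℝ) (r := -p) (by simp; linarith)).const_mul
    (m ^ p)).mono' ?_ (.of_forall fun y ↦ ?_)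
  · refine (Continuous.rpow_const (by fun_prop) fun y ↦ .inl ?_).aestronglyMeasurable
    exact norm_ne_zero_iff.2 (hne y)
  · rw [Real.norm_of_nonneg (by positivity), neg_neg,
      ← Real.mul_rpow hm0.le (by positivity)]
    refine rpow_le_rpow_of_nonpos (by positivity) ?_ (by linarith)
    have h1 : c ≤ ‖(c + y * I : ℂ)‖ := by
      simpa [abs_of_pos hc] using abs_re_le_norm (c + y * I : ℂ)
    have h2 : |y| ≤ ‖(c + y * I : ℂ)‖ := by simpa using abs_im_le_norm (c + y * I : ℂ)
    have h3 : min c 1 ≤ c := min_le_left _ _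
    have h4 : min c 1 * |y| ≤ 1 * |y| := by gcongr; exact min_le_right _ _
    rw [hm, Real.norm_eq_abs]
    linarith

/-- The vertical-line Bromwich integral of `s ^ (-a)` at time `1`. -/
theorem integral_cexp_mul_cpow_neg {a c : ℝ} (ha : 1 < a) (hc : 0 < c) :
    ∫ y : ℝ, cexp (c + y * I) * (c + y * I) ^ (-a : ℂ) = 2 * π / Complex.Gamma a := by
  set g : ℝ → ℂ := (Ioi 0).indicator
    fun t ↦ ((t ^ (a - 1) : ℝ) : ℂ) * cexp (-(c * t)) with hg
  have hG : Complex.Gamma a ≠ 0 := Complex.Gamma_ne_zero_of_re_pos (by simp; linarith)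
  have hgint : Integrable g := by
    rw [hg, integrable_indicator_iff measurableSet_Ioi]
    have := integrableOn_rpow_mul_exp_neg_mul_rpow (s := a - 1) (by linarith) one_pos hc
    refine this.mono' (Measurable.aestronglyMeasurable (by fun_prop)) ?_
    filter_upwards [ae_restrict_mem measurableSet_Ioi] with t ht
    have ht' : 0 < t := ht
    rw [norm_mul, Complex.norm_exp, norm_real, Real.norm_of_nonneg (by positivity)]
    simp
  have hF (ξ : ℝ) : FourierTransform.fourier g ξ =
      (c + (2 * π * ξ : ℝ) * I : ℂ) ^ (-a : ℂ) * Complex.Gamma a := by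
    rw [Real.fourier_real_eq_integral_exp_smul,
      ← integral_rpow_mul_cexp_Ioi (by linarith) (by simpa using hc),
      ← integral_indicator measurableSet_Ioi]
    congr 1 with t
    by_cases ht : t ∈ Ioi (0 : ℝ)
    · simp only [hg, indicator_of_mem ht, smul_eq_mul]
      rw [mul_left_comm, ← Complex.exp_add]
      congr 2
      push_cast
      ring
    · simp [hg, indicator_of_notMem ht]
  have hne (y : ℝ) : (c + y * I : ℂ) ∈ slitPlane := .inl (by simpa using hc)
  have hFint0 : Integrable fun y : ℝ ↦ (c + y * I : ℂ) ^ (-a : ℂ) * Complex.Gamma a := by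
    refine Integrable.mul_const ?_ _
    refine (integrable_norm_add_mul_I_rpow hc (p := -a) (by linarith)).mono' ?_
      (.of_forall fun y ↦ ?_)
    · exact (Continuous.cpow (by fun_prop) continuous_const hne).aestronglyMeasurable
    · rw [← ofReal_neg, norm_cpow_real]
  have hFint : Integrable (FourierTransform.fourier g) := by
    rw [show FourierTransform.fourier g = _ from funext hF]
    exact hFint0.comp_mul_left' (by positivity : 2 * π ≠ 0)
  have hcont : ContinuousAt g 1 := by
    have : ContinuousAt (fun t : ℝ ↦ ((t ^ (a - 1) : ℝ) : ℂ) * cexp (-(c * t))) 1 := by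
      have := Real.continuousAt_rpow_const 1 (a - 1) (.inl one_ne_zero)
      fun_prop
    refine this.congr ?_
    filter_upwards [Ioi_mem_nhds one_pos] with t ht
    simp only [hg, indicator_of_mem ht]
  have hinv := hgint.fourierInv_fourier_eq hFint hcont
  rw [Real.fourierInv_eq'] at hinv
  have hg1 : g 1 = cexp (-c) := by simp [hg]
  have hcomp := Measure.integral_comp_mul_left
    (fun y : ℝ ↦ cexp (c + y * I) * (c + y * I) ^ (-a : ℂ)) (2 * π)
  have : ∫ ξ : ℝ, cexp (c + (2 * π * ξ : ℝ) * I) * (c + (2 * π * ξ : ℝ) * I) ^ (-a : ℂ) =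
      1 / Complex.Gamma a := by
    have h2 : cexp c * g 1 / Complex.Gamma a = 1 / Complex.Gamma a := by
      rw [hg1, ← Complex.exp_add]; simp
    rw [← h2, ← hinv, ← integral_const_mul, ← integral_div]
    congr 1 with ξ
    rw [hF, Complex.exp_add]
    simp
    field_simp
  rw [this, abs_of_pos (by positivity)] at hcomp
  rw [div_eq_mul_one_div, hcomp, real_smul, ← mul_assoc]
  push_cast
  rw [mul_inv_cancel₀ (by simp [pi_ne_zero]), one_mul]

/-- Vertical-line integrals of a holomorphic function do not depend on the line if the function
decays fast enough in the strip between the lines. -/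
theorem integral_vertical_eq_of_norm_le_rpow {f : ℂ → ℂ} {c₁ c₂ K p : ℝ} (hc₁ : 0 < c₁)
    (hc : c₁ ≤ c₂) (hp : p < -1) (hf : DifferentiableOn ℂ f (re ⁻¹' Icc c₁ c₂))
    (hb : ∀ s ∈ re ⁻¹' Icc c₁ c₂, ‖f s‖ ≤ K * ‖s‖ ^ p) :
    ∫ y : ℝ, f (c₁ + y * I) = ∫ y : ℝ, f (c₂ + y * I) := by
  have h_int {c : ℝ} (h : c ∈ Icc c₁ c₂) : Integrable fun y : ℝ ↦ f (c + y * I) := by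
    refine ((integrable_norm_add_mul_I_rpow (hc₁.trans_le h.1) hp).const_mul K).mono' ?_
      (.of_forall fun y ↦ hb _ (by simpa using h))
    exact (hf.continuousOn.comp_continuous (by fun_prop)
      fun y ↦ by simpa using h).aestronglyMeasurable
  have hK : 0 ≤ K := by
    have h := (norm_nonneg _).trans (hb c₁ (by simpa using hc))
    exact nonneg_of_mul_nonneg_left h (by simp; positivity)
  have hlim {c : ℝ} (h : c ∈ Icc c₁ c₂) :
      Tendsto (fun T : ℝ ↦ ∫ y in -T..T, f (c + y * I)) atTop (𝓝 (∫ y : ℝ, f (c + y * I))) :=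
    intervalIntegral_tendsto_integral (h_int h) tendsto_neg_atTop_atBot tendsto_id
  have hdecay : Tendsto (fun T : ℝ ↦ K * T ^ p * |c₂ - c₁|) atTop (𝓝 0) := by
    simpa using ((tendsto_rpow_neg_atTop (y := -p) (by linarith)).const_mul K).mul_const |c₂ - c₁|
  have hhor {σ : ℝ} (hσ : |σ| = 1) :
      Tendsto (fun T : ℝ ↦ ∫ u in c₁..c₂, f (u + (σ * T : ℝ) * I)) atTop (𝓝 0) := by
    refine squeeze_zero_norm' ?_ hdecay
    filter_upwards [eventually_gt_atTop 0] with T hT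
    refine intervalIntegral.norm_integral_le_of_norm_le_const fun u hu ↦ ?_
    rw [uIoc_of_le hc] at hu
    refine (hb _ (by simpa using Ioc_subset_Icc_self hu)).trans ?_
    gcongr ?_ * ?_
    refine rpow_le_rpow_of_nonpos hT ?_ (by linarith)
    simpa [abs_mul, hσ, abs_of_pos hT] using abs_im_le_norm (u + (σ * T : ℝ) * I : ℂ)
  have hzero (T : ℝ) : I * ((∫ y in -T..T, f (c₁ + y * I)) - ∫ y in -T..T, f (c₂ + y * I)) =
      (∫ u in c₁..c₂, f (u + (-1 * T : ℝ) * I)) - ∫ u in c₁..c₂, f (u + (1 * T : ℝ) * I) := by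
    have h := integral_boundary_rect_eq_zero_of_differentiableOn f
      (c₁ + (-T : ℝ) * I) (c₂ + (T : ℝ) * I) (hf.mono fun s hs ↦ by
        have := hs.1
        simpa [uIcc_of_le hc] using! this)
    simp only [add_re, ofReal_re, mul_re, I_re, mul_zero, ofReal_im, I_im, mul_one, sub_self,
      add_zero, add_im, mul_im, zero_add, smul_eq_mul] at h
    rw [neg_one_mul, one_mul]
    linear_combination -h
  have h0 := (((hlim ⟨le_rfl, hc⟩).sub (hlim ⟨hc, le_rfl⟩)).const_mul I).congr hzero
  have h1 := (hhor (σ := -1) (by simp)).sub (hhor (σ := 1) (by simp))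
  rw [sub_zero] at h1
  simpa [I_ne_zero, sub_eq_zero] using tendsto_nhds_unique h0 h1

theorem one_add_cos_mul_pi_div_two_pos {α : ℝ} (hα0 : 0 ≤ α) (hα2 : α < 2) :
    0 < 1 + Real.cos (α * (π / 2)) := by
  have h := Real.cos_lt_cos_of_nonneg_of_le_pi (x := α * (π / 2)) (y := π) (by positivity) le_rfl
    (by nlinarith [pi_pos])
  rw [Real.cos_pi] at h
  linarith

theorem mul_le_norm_cpow_add_sq {α x : ℝ} (hα0 : 0 ≤ α) (hα2 : α < 2) (hx : 0 ≤ x) {s : ℂ}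
    (hs : 0 < s.re) :
    2 * (1 + Real.cos (α * (π / 2))) * (‖s‖ ^ α * x) ≤ ‖s ^ (α : ℂ) + x‖ ^ 2 := by
  have harg : |s.arg| ≤ π / 2 := (abs_arg_lt_pi_div_two_iff.2 (.inl hs)).le
  have hcos : Real.cos (α * (π / 2)) ≤ Real.cos (s.arg * α) := by
    rw [← Real.cos_abs (s.arg * α), abs_mul, abs_of_nonneg hα0, mul_comm]
    exact Real.cos_le_cos_of_nonneg_of_le_pi (by positivity) (by nlinarith [pi_pos]) (by gcongr)
  have hsq : ‖s ^ (α : ℂ) + x‖ ^ 2 =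
      (‖s‖ ^ α - x) ^ 2 + 2 * (1 + Real.cos (s.arg * α)) * (‖s‖ ^ α * x) := by
    have h := Complex.sq_norm (s ^ (α : ℂ))
    rw [norm_cpow_real, normSq_apply] at h
    rw [Complex.sq_norm, normSq_apply]
    simp only [add_re, add_im, ofReal_re, ofReal_im, add_zero]
    have hre := cpow_ofReal_re s α
    linear_combination -h + 2 * x * hre
  rw [hsq]
  have : 0 ≤ ‖s‖ ^ α * x := by positivity
  nlinarith [sq_nonneg (‖s‖ ^ α - x), mul_le_mul_of_nonneg_right hcos this]

/-- The Laplace-type integrand `e ^ s s ^ (α - 2) / (s ^ α + x)` representing `E_{α,2}(-x)`. -/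
noncomputable def mittagLefflerKernel (α x : ℝ) (s : ℂ) : ℂ :=
  cexp s * s ^ ((α - 2 : ℝ) : ℂ) / (s ^ (α : ℂ) + x)

theorem cpow_add_ne_zero {α x : ℝ} (hα0 : 0 ≤ α) (hα2 : α < 2) (hx : 0 < x) {s : ℂ}
    (hs : 0 < s.re) : s ^ (α : ℂ) + x ≠ 0 := fun h ↦ by
  have h1 := mul_le_norm_cpow_add_sq hα0 hα2 hx.le hs
  have h2 := one_add_cos_mul_pi_div_two_pos hα0 hα2
  have h3 : 0 < ‖s‖ := norm_pos_iff.2 fun h ↦ by simp [h] at hs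
  have h4 : 0 < 2 * (1 + Real.cos (α * (π / 2))) * (‖s‖ ^ α * x) := by positivity
  rw [h, norm_zero] at h1
  linarith

theorem norm_mittagLefflerKernel_le {α x : ℝ} (hα0 : 0 ≤ α) (hα2 : α < 2) (hx : 0 < x) {s : ℂ}
    (hs : 0 < s.re) :
    ‖mittagLefflerKernel α x s‖ ≤
      rexp s.re / (√(2 * (1 + Real.cos (α * (π / 2)))) * √x) * ‖s‖ ^ (α / 2 - 2) := by
  have hκ := one_add_cos_mul_pi_div_two_pos hα0 hα2
  have hs0 : 0 < ‖s‖ := norm_pos_iff.2 fun h ↦ by simp [h] at hs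
  have hlow : √(2 * (1 + Real.cos (α * (π / 2)))) * √x * ‖s‖ ^ (α / 2) ≤ ‖s ^ (α : ℂ) + x‖ := by
    refine le_of_sq_le_sq ?_ (norm_nonneg _)
    refine le_trans (le_of_eq ?_) (mul_le_norm_cpow_add_sq hα0 hα2 hx.le hs)
    rw [mul_pow, mul_pow, Real.sq_sqrt (by positivity), Real.sq_sqrt hx.le, ← rpow_mul_natCast
      hs0.le]
    norm_num
    ring
  rw [mittagLefflerKernel, norm_div, norm_mul, norm_cpow_real, Complex.norm_exp]
  refine (div_le_div_of_nonneg_left (by positivity) (by positivity) hlow).trans (le_of_eq ?_)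
  rw [show α - 2 = (α / 2 - 2) + α / 2 by ring, rpow_add hs0]
  field_simp

theorem integral_mittagLefflerKernel_of_lt {α x c : ℝ} (hα0 : 0 ≤ α) (hx : 0 ≤ x) (hc : 0 < c)
    (hxc : x < c ^ α) :
    ∫ y : ℝ, mittagLefflerKernel α x (c + y * I) = 2 * π * mittagLeffler α 2 ((-x : ℝ) : ℂ) := by
  set F : ℕ → ℝ → ℂ := fun k y ↦ ((-x : ℝ) : ℂ) ^ k *
    (cexp (c + y * I) * (c + y * I) ^ (-(α * k + 2 : ℝ) : ℂ)) with hF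
  have hre (y : ℝ) : (c + y * I : ℂ).re = c := by simp
  have hslit (y : ℝ) : (c + y * I : ℂ) ∈ slitPlane := .inl (by simpa using hc)
  have hle (y : ℝ) : c ≤ ‖(c + y * I : ℂ)‖ := by
    simpa [abs_of_pos hc] using abs_re_le_norm (c + y * I : ℂ)
  have hcα : 0 < c ^ α := by positivity
  have hnorm (k : ℕ) (y : ℝ) :
      ‖F k y‖ ≤ (x / c ^ α) ^ k * (rexp c * ‖(c + y * I : ℂ)‖ ^ (-2 : ℝ)) := by
    have hpos := hc.trans_le (hle y)
    rw [hF]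
    simp only
    rw [norm_mul, norm_mul, norm_pow, norm_real, Complex.norm_exp, hre, ← ofReal_neg,
      norm_cpow_real, norm_neg, Real.norm_of_nonneg hx, neg_add, rpow_add hpos, div_pow,
      ← rpow_mul_natCast hc.le, rpow_neg hpos.le, div_eq_mul_inv]
    have : (‖(c + y * I : ℂ)‖ ^ (α * k))⁻¹ ≤ (c ^ (α * k))⁻¹ := by
      gcongr
      exact hle y
    calc _ = x ^ k * (‖(c + y * I : ℂ)‖ ^ (α * k))⁻¹ *
          (rexp c * ‖(c + y * I : ℂ)‖ ^ (-2 : ℝ)) := by ring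
      _ ≤ _ := by gcongr
  have hdom := (integrable_norm_add_mul_I_rpow hc (p := -2) (by norm_num)).const_mul (rexp c)
  have hFint (k : ℕ) : Integrable (F k) := by
    refine (hdom.const_mul ((x / c ^ α) ^ k)).mono' ?_ (.of_forall (hnorm k))
    refine Continuous.aestronglyMeasurable ?_
    have : Continuous fun y : ℝ ↦ (c + y * I : ℂ) ^ (-(α * k + 2 : ℝ) : ℂ) :=
      Continuous.cpow (by fun_prop) continuous_const hslit
    fun_prop
  have hgeom : x / c ^ α < 1 := (div_lt_one hcα).2 hxc
  have hsum : Summable fun k ↦ ∫ y, ‖F k y‖ := by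
    refine Summable.of_nonneg_of_le (fun k ↦ by positivity) (fun k ↦ ?_)
      ((summable_geometric_of_lt_one (by positivity) hgeom).mul_right
        (∫ y : ℝ, rexp c * ‖(c + y * I : ℂ)‖ ^ (-2 : ℝ)))
    rw [← integral_const_mul]
    exact integral_mono (hFint k).norm (hdom.const_mul _) (hnorm k)
  have hS := (hasSum_integral_of_summable_integral_norm hFint hsum).tsum_eq
  have hterm (k : ℕ) : ∫ y, F k y =
      2 * π * (((-x : ℝ) : ℂ) ^ k / Complex.Gamma ((α * k + 2 : ℝ) : ℂ)) := by
    have : 0 ≤ α * k := by positivity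
    rw [hF, integral_const_mul, integral_cexp_mul_cpow_neg (by linarith) hc]
    ring
  simp only [hterm, tsum_mul_left] at hS
  rw [mittagLeffler, hS]
  congr 1 with y
  set s : ℂ := c + y * I with hs
  have hs0 : s ≠ 0 := slitPlane_ne_zero (hslit y)
  have hsα : s ^ (α : ℂ) ≠ 0 := by simp [cpow_eq_zero_iff, hs0]
  have hratio : ‖((-x : ℝ) : ℂ) / s ^ (α : ℂ)‖ < 1 := by
    rw [norm_div, norm_cpow_real, norm_real, norm_neg, Real.norm_of_nonneg hx]
    refine lt_of_le_of_lt ?_ hgeom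
    gcongr
    exact hle y
  have hFk (k : ℕ) : F k y = cexp s * (s ^ (2 : ℂ))⁻¹ * (((-x : ℝ) : ℂ) / s ^ (α : ℂ)) ^ k := by
    simp only [hF]
    rw [← hs, cpow_neg, ofReal_add, ofReal_mul, ofReal_natCast, cpow_add _ _ hs0, cpow_mul_nat,
      div_pow, ofReal_ofNat]
    field_simp
  simp only [hFk]
  rw [tsum_mul_left, tsum_geometric_of_norm_lt_one hratio, mittagLefflerKernel, ofReal_sub,
    cpow_sub _ _ hs0, ofReal_ofNat]
  have hne : s ^ (α : ℂ) + x ≠ 0 := by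
    intro h
    have : ((-x : ℝ) : ℂ) = s ^ (α : ℂ) := by push_cast; linear_combination -h
    rw [this, div_self hsα, norm_one] at hratio
    exact lt_irrefl _ hratio
  rw [one_sub_div hsα, inv_div]
  push_cast
  rw [sub_neg_eq_add]
  field_simp

/-- Bromwich representation of `E_{α,2}(-x)` on the line `re s = 1`. -/
theorem integral_mittagLefflerKernel {α x : ℝ} (hα0 : 0 < α) (hα2 : α < 2) (hx : 0 < x) :
    ∫ y : ℝ, mittagLefflerKernel α x ((1 : ℝ) + y * I) =
      2 * π * mittagLeffler α 2 ((-x : ℝ) : ℂ) := by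
  set c : ℝ := (1 + x) ^ α⁻¹ with hc
  have hc1 : 1 ≤ c := one_le_rpow (by linarith) (by positivity)
  rw [← integral_mittagLefflerKernel_of_lt hα0.le hx.le (c := c) (by positivity)
    (by rw [hc, rpow_inv_rpow (by positivity) hα0.ne']; linarith)]
  refine integral_vertical_eq_of_norm_le_rpow (p := α / 2 - 2)
    (K := rexp c / (√(2 * (1 + Real.cos (α * (π / 2)))) * √x)) one_pos hc1 (by linarith) ?_ ?_
  · intro s hs
    have hs' : 0 < s.re := one_pos.trans_le hs.1
    have hid : DifferentiableAt ℂ (fun s : ℂ ↦ s) s := differentiableAt_id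
    exact ((differentiableAt_exp.mul (hid.cpow_const (.inl hs'))).div
      ((hid.cpow_const (.inl hs')).add_const _)
      (cpow_add_ne_zero hα0.le hα2 hx hs')).differentiableWithinAt
  · intro s hs
    refine (norm_mittagLefflerKernel_le hα0.le hα2 hx (one_pos.trans_le hs.1)).trans ?_
    gcongr
    exact hs.2

theorem exists_sqrt_mul_norm_mittagLeffler_two_le {α : ℝ} (hα0 : 0 < α) (hα2 : α < 2) :
    ∃ C : ℝ, 0 < C ∧ ∀ x : ℝ, 0 < x → √x * ‖mittagLeffler α 2 ((-x : ℝ) : ℂ)‖ ≤ C := by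
  have hκ := one_add_cos_mul_pi_div_two_pos hα0.le hα2
  set κ := √(2 * (1 + Real.cos (α * (π / 2))))
  have hκ0 : 0 < κ := by positivity
  set J := ∫ y : ℝ, ‖((1 : ℝ) + y * I : ℂ)‖ ^ (α / 2 - 2) with hJ
  have hJ0 : 0 ≤ J := by positivity
  refine ⟨rexp 1 / κ * J + 1, by positivity, fun x hx ↦ ?_⟩
  have hb : ‖∫ y : ℝ, mittagLefflerKernel α x ((1 : ℝ) + y * I)‖ ≤
      rexp 1 / (κ * √x) * J := by
    rw [hJ, ← integral_const_mul]
    refine norm_integral_le_of_norm_le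
      ((integrable_norm_add_mul_I_rpow one_pos (by linarith)).const_mul _) (.of_forall fun y ↦ ?_)
    have hre : ((1 : ℝ) + y * I : ℂ).re = 1 := by simp
    have h := norm_mittagLefflerKernel_le hα0.le hα2 hx (hre ▸ one_pos)
    rw [hre] at h
    exact h
  rw [integral_mittagLefflerKernel hα0 hα2 hx, norm_mul] at hb
  have h2π : 1 ≤ ‖(2 * π : ℂ)‖ := by
    simp [abs_of_pos pi_pos]
    linarith [pi_gt_three]
  have hE := (le_mul_of_one_le_left (norm_nonneg _) h2π).trans hb
  have hx' : 0 < √x := Real.sqrt_pos.2 hx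
  calc _ ≤ √x * (rexp 1 / (κ * √x) * J) := by gcongr
    _ = rexp 1 / κ * J := by field_simp
    _ ≤ _ := by linarith

/-- For `1 < α < 2` there is `C > 0` with
`λ^{1/2} t |E_{α,2}(-λ t^α)| ≤ C t^{1 - α/2}` for all `λ, t > 0`. -/
theorem mittagLeffler_E2_weighted_bound (α : ℝ) (hα1 : 1 < α) (hα2 : α < 2) :
    ∃ C : ℝ, 0 < C ∧ ∀ l t : ℝ, 0 < l → 0 < t →
      l ^ (1 / 2 : ℝ) * t * ‖mittagLeffler α 2 ((-(l * t ^ α) : ℝ) : ℂ)‖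
        ≤ C * t ^ (1 - α / 2) := by
  obtain ⟨C, hC, h⟩ := exists_sqrt_mul_norm_mittagLeffler_two_le (one_pos.trans hα1) hα2
  refine ⟨C, hC, fun l t hl ht ↦ ?_⟩
  have hsplit : l ^ (1 / 2 : ℝ) * t = √(l * t ^ α) * t ^ (1 - α / 2) := by
    rw [Real.sqrt_eq_rpow, Real.mul_rpow hl.le (by positivity), ← rpow_mul ht.le, mul_assoc,
      ← rpow_add ht, show α * (1 / 2) + (1 - α / 2) = 1 by ring, rpow_one]
  rw [hsplit, mul_right_comm]
  gcongr
  exact h _ (by positivity)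
end

section
/- Let 1 < α < 2, T > 0 and θ ∈ ((2−α)/(2α), 1/2]. Let (λ_n) be a sequence of positive reals, and let (a_n), (b_n) be real sequences with Σ_n λ_n a_n² < ∞ and Σ_n b_n² < ∞. Then: (i) lim_{t→0⁺} Σ_{n=1}^∞ λ_n^{−2θ} | −λ_n a_n t^{α−1} E_{α,α}(−λ_n t^α) + b_n (E_{α,1}(−λ_n t^α) − 1) |² = 0; and (ii) there exists C > 0 such that for every t ∈ [0,T], Σ_{n=1}^∞ λ_n^{−2θ} | −λ_n a_n t^{α−1} E_{α,α}(−λ_n t^α) + b_n E_{α,1}(−λ_n t^α) |² ≤ C ( Σ_n λ_n a_n² + Σ_n b_n² ). (This is the spectral-coefficient form of the statement that ∂_t u ∈ C([0,T];D(A^{−θ})) with ∂_t u(t,·) → u₁ in D(A^{−θ}) as t → 0.) -/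
open Complex Real Filter Topology

section

open MeasureTheory

/-- The real Mittag–Leffler function `E_{α,β}` evaluated at `-x`. -/
noncomputable def mittagLefflerNeg (α β x : ℝ) : ℝ :=
  ∑' k : ℕ, (-x) ^ k / Real.Gamma (α * k + β)

theorem summable_pow_div_Gamma {α β : ℝ} (hα : 1 ≤ α) (hβ : 0 < β) (x : ℝ) :
    Summable fun k : ℕ => x ^ k / Real.Gamma (α * k + β) := by
  have hb : Summable fun k : ℕ => |x| ^ 3 * (|x| ^ k / (k.factorial : ℝ)) * (k + 1) := by
    have h1 := (Real.summable_pow_div_factorial |x|).mul_left (|x| ^ 4)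
    have h2 := (Real.summable_pow_div_factorial |x|).mul_left (|x| ^ 3)
    have h3 : Summable fun k : ℕ => |x| ^ 3 * (|x| ^ k / (k.factorial : ℝ)) * k := by
      rw [← summable_nat_add_iff 1]
      refine h1.congr fun k => ?_
      have : (k.factorial : ℝ) ≠ 0 := by positivity
      rw [Nat.factorial_succ]
      push_cast
      field_simp
      ring
    refine (h3.add h2).congr fun k => by ring
  rw [← summable_nat_add_iff 3]
  refine Summable.of_norm_bounded hb fun k => ?_
  have hge : (k : ℝ) + 2 + 1 ≤ α * ((k + 3 : ℕ) : ℝ) + β := by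
    push_cast
    nlinarith [(Nat.cast_nonneg k : (0 : ℝ) ≤ k)]
  have hG : (k.factorial : ℝ) ≤ Real.Gamma (α * ((k + 3 : ℕ) : ℝ) + β) := by
    calc (k.factorial : ℝ) ≤ ((k + 2).factorial : ℝ) := by
          exact_mod_cast Nat.factorial_le (by omega)
      _ = Real.Gamma ((k : ℝ) + 2 + 1) := by
          rw [← Real.Gamma_nat_eq_factorial]; push_cast; rfl
      _ ≤ _ := Real.Gamma_strictMonoOn_Ici.monotoneOn
          (by simp only [Set.mem_Ici]; linarith [(Nat.cast_nonneg k : (0 : ℝ) ≤ k)])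
          (by simp only [Set.mem_Ici]; linarith [(Nat.cast_nonneg k : (0 : ℝ) ≤ k)]) hge
  have hk : (0 : ℝ) < k.factorial := by positivity
  rw [norm_div, norm_pow, Real.norm_eq_abs, Real.norm_eq_abs, abs_of_pos (hk.trans_le hG)]
  calc |x| ^ (k + 3) / Real.Gamma (α * ((k + 3 : ℕ) : ℝ) + β)
      ≤ |x| ^ (k + 3) / k.factorial := by gcongr
    _ = |x| ^ 3 * (|x| ^ k / (k.factorial : ℝ)) * 1 := by ring
    _ ≤ _ := by gcongr; linarith [(Nat.cast_nonneg k : (0 : ℝ) ≤ k)]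

theorem continuous_mittagLefflerNeg {α β : ℝ} (hα : 1 ≤ α) (hβ : 0 < β) :
    Continuous (mittagLefflerNeg α β) := by
  rw [continuous_iff_continuousAt]
  intro x
  have hc : ContinuousOn (mittagLefflerNeg α β) (Metric.ball 0 (|x| + 1)) := by
    refine continuousOn_tsum (fun k => by fun_prop)
      (summable_pow_div_Gamma hα hβ (|x| + 1)) fun k y hy => ?_
    have hG : 0 < Real.Gamma (α * k + β) := Real.Gamma_pos_of_pos (by positivity)
    rw [norm_div, norm_pow, norm_neg, Real.norm_eq_abs (Real.Gamma _), abs_of_pos hG]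
    have : ‖y‖ ≤ |x| + 1 := by simpa using (mem_ball_zero_iff.1 hy).le
    gcongr
  exact hc.continuousAt (Metric.isOpen_ball.mem_nhds (by simp))

theorem mittagLefflerNeg_zero (α β : ℝ) : mittagLefflerNeg α β 0 = (Real.Gamma β)⁻¹ := by
  rw [mittagLefflerNeg, tsum_eq_single 0 (fun k hk => by simp [hk])]
  simp

theorem mittagLefflerNeg_eq_sub {α β : ℝ} (hα : 1 ≤ α) (hβ : 0 < β) (x : ℝ) :
    mittagLefflerNeg α β x = (Real.Gamma β)⁻¹ - x * mittagLefflerNeg α (α + β) x := by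
  rw [mittagLefflerNeg, (summable_pow_div_Gamma hα hβ (-x)).tsum_eq_zero_add, mittagLefflerNeg,
    ← tsum_mul_left, sub_eq_add_neg, ← tsum_neg]
  congr 1
  · simp
  · refine tsum_congr fun k => ?_
    rw [show α * ((k + 1 : ℕ) : ℝ) + β = α * k + (α + β) by push_cast; ring, pow_succ]
    ring

theorem mittagLeffler_ofReal_neg (α β x : ℝ) :
    mittagLeffler α β ((-x : ℝ) : ℂ) = (mittagLefflerNeg α β x : ℂ) := by
  rw [mittagLeffler, mittagLefflerNeg, Complex.ofReal_tsum]
  refine tsum_congr fun k => ?_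
  rw [Complex.Gamma_ofReal]
  push_cast
  rfl

theorem integral_rpow_mul_sub_rpow {β γ t : ℝ} (hβ : 0 < β) (hγ : 0 < γ) (ht : 0 < t) :
    ∫ s in (0 : ℝ)..t, s ^ (β - 1) * (t - s) ^ (γ - 1) =
      t ^ (β + γ - 1) * (Real.Gamma β * Real.Gamma γ / Real.Gamma (β + γ)) := by
  have h := Complex.betaIntegral_scaled (β : ℂ) (γ : ℂ) ht
  rw [Complex.betaIntegral_eq_Gamma_mul_div _ _ (by simpa) (by simpa)] at h
  have h2 : ∫ x in (0 : ℝ)..t, (x : ℂ) ^ ((β : ℂ) - 1) * ((t : ℂ) - x) ^ ((γ : ℂ) - 1) =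
      ((∫ s in (0 : ℝ)..t, s ^ (β - 1) * (t - s) ^ (γ - 1) : ℝ) : ℂ) := by
    rw [← intervalIntegral.integral_ofReal]
    refine intervalIntegral.integral_congr fun s hs => ?_
    rw [Set.uIcc_of_le ht.le] at hs
    rw [Complex.ofReal_mul, Complex.ofReal_cpow hs.1, Complex.ofReal_cpow (sub_nonneg.2 hs.2)]
    push_cast
    rfl
  rw [h2] at h
  apply Complex.ofReal_injective
  rw [h, Complex.ofReal_mul, Complex.ofReal_cpow ht.le]
  push_cast [← Complex.Gamma_ofReal]
  rfl

theorem intervalIntegrable_rpow_mul_sub_rpow {β γ t : ℝ} (hβ : 0 < β) (hγ : 0 < γ) (ht : 0 < t) :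
    IntervalIntegrable (fun s : ℝ => s ^ (β - 1) * (t - s) ^ (γ - 1)) volume 0 t := by
  by_contra h
  have h1 := integral_rpow_mul_sub_rpow hβ hγ ht
  rw [intervalIntegral.integral_undef h] at h1
  have := Real.Gamma_pos_of_pos hβ
  have := Real.Gamma_pos_of_pos hγ
  have := Real.Gamma_pos_of_pos (add_pos hβ hγ)
  have : 0 < t ^ (β + γ - 1) * (Real.Gamma β * Real.Gamma γ / Real.Gamma (β + γ)) := by positivity
  linarith

/-- The relaxation function `t ^ (β - 1) * E_{α,β}(-t ^ α)`. -/
noncomputable def relaxation (α β t : ℝ) : ℝ :=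
  t ^ (β - 1) * mittagLefflerNeg α β (t ^ α)

/-- Riemann–Liouville integration of order `γ` raises the second index of the relaxation function
by `γ`. -/
theorem integral_sub_rpow_mul_relaxation {α β γ t : ℝ} (hα : 1 ≤ α) (hβ : 0 < β) (hγ : 0 < γ)
    (ht : 0 < t) :
    ∫ s in (0 : ℝ)..t, (t - s) ^ (γ - 1) * relaxation α β s =
      Real.Gamma γ * relaxation α (β + γ) t := by
  have hα0 : 0 < α := by linarith
  have hsum := intervalIntegral.hasSum_integral_of_dominated_convergence (μ := volume)
    (a := 0) (b := t)
    (F := fun (k : ℕ) (s : ℝ) =>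
      (-1) ^ k / Real.Gamma (α * k + β) * (s ^ ((α * k + β) - 1) * (t - s) ^ (γ - 1)))
    (f := fun s => (t - s) ^ (γ - 1) * relaxation α β s)
    (fun k s => (t ^ α) ^ k / Real.Gamma (α * k + β) * (s ^ (β - 1) * (t - s) ^ (γ - 1)))
    (fun k => by
      have : Measurable fun s : ℝ =>
        (-1) ^ k / Real.Gamma (α * k + β) * (s ^ ((α * k + β) - 1) * (t - s) ^ (γ - 1)) := by
        fun_prop
      exact this.aestronglyMeasurable)
    (fun k => Filter.Eventually.of_forall fun s hs => ?_)
    (Filter.Eventually.of_forall fun s hs => (summable_pow_div_Gamma hα hβ (t ^ α)).mul_right _)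
    ?_
    (Filter.Eventually.of_forall fun s hs => ?_)
  · have hval : ∀ k : ℕ, ∫ s in (0 : ℝ)..t,
        (-1) ^ k / Real.Gamma (α * k + β) * (s ^ ((α * k + β) - 1) * (t - s) ^ (γ - 1)) =
        Real.Gamma γ * (t ^ (β + γ - 1) * ((-(t ^ α)) ^ k / Real.Gamma (α * k + (β + γ)))) := by
      intro k
      have hk : 0 < α * k + β := by positivity
      rw [intervalIntegral.integral_const_mul, integral_rpow_mul_sub_rpow hk hγ ht]
      have h1 : t ^ (α * k + β + γ - 1) = t ^ (β + γ - 1) * (t ^ α) ^ k := by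
        rw [← Real.rpow_natCast (t ^ α), ← Real.rpow_mul ht.le, ← Real.rpow_add ht]
        ring_nf
      rw [h1, neg_pow (t ^ α), ← add_assoc]
      have := (Real.Gamma_pos_of_pos hk).ne'
      field_simp
    simp_rw [hval] at hsum
    rw [← hsum.tsum_eq, tsum_mul_left, tsum_mul_left]
    rfl
  · rw [Set.uIoc_of_le ht.le] at hs
    have hG : 0 < Real.Gamma (α * k + β) := Real.Gamma_pos_of_pos (by positivity)
    have h1 : s ^ (α * k + β - 1) = (s ^ α) ^ k * s ^ (β - 1) := by
      rw [← Real.rpow_natCast (s ^ α), ← Real.rpow_mul hs.1.le, ← Real.rpow_add hs.1]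
      ring_nf
    have h2 : 0 ≤ t - s := sub_nonneg.2 hs.2
    have hs0 := hs.1
    rw [h1, norm_mul, norm_div, norm_pow, norm_neg, norm_one, one_pow,
      Real.norm_of_nonneg hG.le, Real.norm_of_nonneg (by positivity)]
    have : s ^ α ≤ t ^ α := Real.rpow_le_rpow hs.1.le hs.2 hα0.le
    calc 1 / Real.Gamma (α * k + β) * ((s ^ α) ^ k * s ^ (β - 1) * (t - s) ^ (γ - 1))
        ≤ 1 / Real.Gamma (α * k + β) * ((t ^ α) ^ k * s ^ (β - 1) * (t - s) ^ (γ - 1)) := by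
          gcongr
      _ = _ := by ring
  · simp_rw [tsum_mul_right]
    exact (intervalIntegrable_rpow_mul_sub_rpow hβ hγ ht).const_mul _
  · rw [Set.uIoc_of_le ht.le] at hs
    have h := ((summable_pow_div_Gamma hα hβ (-(s ^ α))).hasSum.mul_left
      ((t - s) ^ (γ - 1) * s ^ (β - 1)))
    rw [relaxation, mittagLefflerNeg, ← mul_assoc]
    refine h.congr_fun fun k => ?_
    have h1 : s ^ (α * k + β - 1) = (s ^ α) ^ k * s ^ (β - 1) := by
      rw [← Real.rpow_natCast (s ^ α), ← Real.rpow_mul hs.1.le, ← Real.rpow_add hs.1]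
      ring_nf
    rw [h1, neg_pow (s ^ α)]
    ring

theorem relaxation_eq_sub {α β t : ℝ} (hα : 1 ≤ α) (hβ : 0 < β) (ht : 0 < t) :
    relaxation α β t = t ^ (β - 1) / Real.Gamma β - relaxation α (β + α) t := by
  rw [relaxation, mittagLefflerNeg_eq_sub hα hβ, relaxation, add_comm α β,
    show β + α - 1 = (β - 1) + α by ring, Real.rpow_add ht]
  ring

theorem continuous_relaxation {α β : ℝ} (hα : 1 ≤ α) (hβ : 1 ≤ β) :
    Continuous (relaxation α β) := by
  have h1 : Continuous fun t : ℝ => t ^ (β - 1) := Real.continuous_rpow_const (by linarith)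
  have h2 : Continuous fun t : ℝ => t ^ α := Real.continuous_rpow_const (by linarith)
  exact h1.mul ((continuous_mittagLefflerNeg hα (by linarith)).comp h2)

theorem continuousAt_relaxation {α β t : ℝ} (hα : 1 ≤ α) (hβ : 0 < β) (ht : 0 < t) :
    ContinuousAt (relaxation α β) t :=
  (Real.continuousAt_rpow_const _ _ (Or.inl ht.ne')).mul
    ((continuous_mittagLefflerNeg hα hβ).continuousAt.comp
      (Real.continuousAt_rpow_const _ _ (Or.inl ht.ne')))

theorem intervalIntegrable_relaxation {α β : ℝ} (hα : 1 ≤ α) (hβ : 0 < β) (a b : ℝ) :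
    IntervalIntegrable (relaxation α β) volume a b :=
  (intervalIntegral.intervalIntegrable_rpow' (by linarith)).mul_continuousOn
    ((continuous_mittagLefflerNeg hα hβ).comp
      (Real.continuous_rpow_const (by linarith))).continuousOn

/-- Convolution of `f` with the exponential kernel `exp (-r t)`. -/
noncomputable def expConvolution (f : ℝ → ℝ) (r t : ℝ) : ℝ :=
  Real.exp (-(r * t)) * ∫ s in (0 : ℝ)..t, Real.exp (r * s) * f s

theorem continuous_expConvolution {f : ℝ → ℝ} (hf : Continuous f) :
    Continuous fun p : ℝ × ℝ => expConvolution f p.2 p.1 := by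
  have h : Continuous fun p : ℝ × ℝ => ∫ s in (0 : ℝ)..p.1, Real.exp (p.2 * s) * f s :=
    intervalIntegral.continuous_parametric_intervalIntegral_of_continuous
      (f := fun (p : ℝ × ℝ) s => Real.exp (p.2 * s) * f s)
      (by simp only [Function.uncurry_def]; fun_prop) continuous_fst
  unfold expConvolution
  fun_prop

theorem hasDerivAt_expConvolution {f : ℝ → ℝ} (hf : Continuous f) (r t : ℝ) :
    HasDerivAt (expConvolution f r) (f t - r * expConvolution f r t) t := by
  have h1 : HasDerivAt (fun t => Real.exp (-(r * t))) (Real.exp (-(r * t)) * -(r * 1)) t :=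
    (((hasDerivAt_id t).const_mul r).neg).exp
  have hc : Continuous fun s => Real.exp (r * s) * f s := by fun_prop
  have h2 := hc.integral_hasStrictDerivAt 0 t |>.hasDerivAt
  convert! h1.mul h2 using 1
  rw [expConvolution, ← mul_assoc (Real.exp (-(r * t))) (Real.exp (r * t)), ← Real.exp_add]
  simp
  ring

theorem integral_mul_expConvolution_nonneg {f : ℝ → ℝ} (hf : Continuous f) {r T : ℝ} (hr : 0 ≤ r)
    (hT : 0 ≤ T) : 0 ≤ ∫ t in (0 : ℝ)..T, f t * expConvolution f r t := by
  have hw : Continuous (expConvolution f r) :=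
    continuous_iff_continuousAt.2 fun t => (hasDerivAt_expConvolution hf r t).continuousAt
  have h0 : expConvolution f r 0 = 0 := by simp [expConvolution]
  have h := intervalIntegral.integral_eq_sub_of_hasDerivAt
    (f := fun t => expConvolution f r t ^ 2) (a := 0) (b := T)
    (fun t _ => (hasDerivAt_expConvolution hf r t).fun_pow 2)
    (Continuous.intervalIntegrable (by fun_prop) _ _)
  have hsplit : ∫ t in (0 : ℝ)..T, f t * expConvolution f r t =
      (∫ t in (0 : ℝ)..T, r * expConvolution f r t ^ 2) + 1 / 2 *
        ∫ t in (0 : ℝ)..T, ((2 : ℕ) : ℝ) * expConvolution f r t ^ (2 - 1) *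
          (f t - r * expConvolution f r t) := by
    rw [← intervalIntegral.integral_const_mul, ← intervalIntegral.integral_add
      (Continuous.intervalIntegrable (by fun_prop) _ _)
      (Continuous.intervalIntegrable (by fun_prop) _ _)]
    congr 1
    ext t
    push_cast
    ring
  rw [hsplit, h, h0]
  have : 0 ≤ ∫ t in (0 : ℝ)..T, r * expConvolution f r t ^ 2 :=
    intervalIntegral.integral_nonneg hT fun t _ => by positivity
  nlinarith [sq_nonneg (expConvolution f r T)]

theorem abs_expConvolution_le {f : ℝ → ℝ} {M r t T : ℝ} (hr : 0 < r) (ht : 0 ≤ t) (htT : t ≤ T)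
    (hM : ∀ s ∈ Set.Icc 0 t, |f s| ≤ M) :
    |expConvolution f r t| ≤ M * min T r⁻¹ := by
  have hM0 : 0 ≤ M := (abs_nonneg _).trans (hM 0 ⟨le_rfl, ht⟩)
  have hpt : ∀ s ∈ Set.Ioc 0 t, ‖Real.exp (r * s) * f s‖ ≤ M * Real.exp (r * s) := by
    intro s hs
    rw [norm_mul, Real.norm_of_nonneg (Real.exp_pos _).le, mul_comm]
    gcongr
    exact hM s ⟨hs.1.le, hs.2⟩
  have hexp : Real.exp (-(r * t)) * Real.exp (r * t) = 1 := by rw [← Real.exp_add]; simp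
  rw [expConvolution, abs_mul, abs_of_pos (Real.exp_pos _), mul_min_of_nonneg _ _ hM0]
  refine le_min ?_ ?_
  · have h := intervalIntegral.norm_integral_le_of_norm_le_const (a := 0) (b := t)
      (f := fun s => Real.exp (r * s) * f s) (C := M * Real.exp (r * t)) (fun s hs => by
        rw [Set.uIoc_of_le ht] at hs
        refine (hpt s hs).trans ?_
        have := hs.2
        gcongr)
    rw [Real.norm_eq_abs, sub_zero, abs_of_nonneg ht] at h
    calc Real.exp (-(r * t)) * |∫ s in (0 : ℝ)..t, Real.exp (r * s) * f s|
        ≤ Real.exp (-(r * t)) * (M * Real.exp (r * t) * t) := by gcongr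
      _ = M * t * (Real.exp (-(r * t)) * Real.exp (r * t)) := by ring
      _ ≤ M * T := by rw [hexp, mul_one]; gcongr
  · have h := intervalIntegral.norm_integral_le_of_norm_le ht
      (f := fun s => Real.exp (r * s) * f s) (g := fun s => M * Real.exp (r * s)) (μ := volume)
      (Filter.Eventually.of_forall hpt) (Continuous.intervalIntegrable (by fun_prop) _ _)
    rw [intervalIntegral.integral_const_mul,
      intervalIntegral.integral_comp_mul_left (fun x => Real.exp x) hr.ne', integral_exp,
      Real.norm_eq_abs] at h
    calc Real.exp (-(r * t)) * |∫ s in (0 : ℝ)..t, Real.exp (r * s) * f s|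
        ≤ Real.exp (-(r * t)) * (M * (r⁻¹ • (Real.exp (r * t) - Real.exp (r * 0)))) := by gcongr
      _ = M * r⁻¹ * (Real.exp (-(r * t)) * Real.exp (r * t) - Real.exp (-(r * t))) := by
          rw [smul_eq_mul, mul_zero, Real.exp_zero]; ring
      _ ≤ M * r⁻¹ * 1 := by
          rw [hexp]
          gcongr
          linarith [Real.exp_pos (-(r * t))]
      _ = M * r⁻¹ := mul_one _

theorem integral_rpow_neg_mul_exp {γ x : ℝ} (hγ : γ < 1) (hx : 0 < x) :
    ∫ r in Set.Ioi (0 : ℝ), r ^ (-γ) * Real.exp (-(x * r)) = Real.Gamma (1 - γ) * x ^ (γ - 1) := by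
  have h := Real.integral_rpow_mul_exp_neg_mul_Ioi (a := 1 - γ) (by linarith) hx
  rw [show 1 - γ - 1 = -γ by ring] at h
  rw [h, one_div, Real.inv_rpow hx.le, ← Real.rpow_neg hx.le, neg_sub, mul_comm]

theorem integrableOn_rpow_neg_mul_exp {γ x : ℝ} (hγ : γ < 1) (hx : 0 < x) :
    IntegrableOn (fun r : ℝ => r ^ (-γ) * Real.exp (-(x * r))) (Set.Ioi 0) := by
  by_contra h
  have h1 := integral_rpow_neg_mul_exp hγ hx
  rw [integral_undef h] at h1
  have := Real.Gamma_pos_of_pos (sub_pos.2 hγ)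
  have : 0 < Real.Gamma (1 - γ) * x ^ (γ - 1) := by positivity
  linarith

theorem integrableOn_rpow_neg_mul_min {γ T : ℝ} (hγ0 : 0 < γ) (hγ : γ < 1) (hT : 0 ≤ T) :
    IntegrableOn (fun r : ℝ => r ^ (-γ) * min T r⁻¹) (Set.Ioi 0) := by
  have hmeas : Measurable fun r : ℝ => r ^ (-γ) * min T r⁻¹ := by fun_prop
  rw [← Set.Ioc_union_Ioi_eq_Ioi (zero_le_one (α := ℝ)), integrableOn_union]
  constructor
  · have h : IntegrableOn (fun r : ℝ => r ^ (-γ) * T) (Set.Ioc 0 1) :=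
      ((intervalIntegrable_iff_integrableOn_Ioc_of_le zero_le_one).1
        (intervalIntegral.intervalIntegrable_rpow' (by linarith))).mul_const T
    refine h.mono' hmeas.aestronglyMeasurable ?_
    refine (ae_restrict_iff' measurableSet_Ioc).2 (Filter.Eventually.of_forall fun r hr => ?_)
    have hr0 := hr.1
    rw [Real.norm_of_nonneg (by positivity)]
    gcongr
    exact min_le_left _ _
  · have h : IntegrableOn (fun r : ℝ => r ^ (-γ - 1)) (Set.Ioi 1) :=
      integrableOn_Ioi_rpow_of_lt (by linarith) one_pos
    refine h.mono' hmeas.aestronglyMeasurable ?_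
    refine (ae_restrict_iff' measurableSet_Ioi).2 (Filter.Eventually.of_forall fun r hr => ?_)
    have hr0 : 0 < r := one_pos.trans hr
    rw [Real.norm_of_nonneg (by positivity), Real.rpow_sub_one hr0.ne', div_eq_mul_inv]
    gcongr
    exact min_le_right _ _

theorem intervalIntegrable_sub_rpow {γ t : ℝ} (hγ : 0 < γ) :
    IntervalIntegrable (fun s : ℝ => (t - s) ^ (γ - 1)) volume 0 t := by
  have h := (intervalIntegral.intervalIntegrable_rpow' (a := 0) (b := t)
    (r := γ - 1) (by linarith)).comp_sub_left t
  simpa using h.symm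

/-- A fractional integral is a superposition of exponential convolutions. -/
theorem integral_sub_rpow_mul_eq {f : ℝ → ℝ} (hf : Continuous f) {γ t : ℝ} (hγ0 : 0 < γ)
    (hγ : γ < 1) (ht : 0 ≤ t) :
    Real.Gamma (1 - γ) * ∫ s in (0 : ℝ)..t, (t - s) ^ (γ - 1) * f s =
      ∫ r in Set.Ioi (0 : ℝ), r ^ (-γ) * expConvolution f r t := by
  have hint : Integrable
      (Function.uncurry fun s r : ℝ => r ^ (-γ) * Real.exp (-((t - s) * r)) * f s)
      ((volume.restrict (Set.Ioo 0 t)).prod (volume.restrict (Set.Ioi 0))) := by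
    have hmeas : Measurable
        (Function.uncurry fun s r : ℝ => r ^ (-γ) * Real.exp (-((t - s) * r)) * f s) := by
      simp only [Function.uncurry_def]
      have := hf.measurable
      fun_prop
    rw [integrable_prod_iff hmeas.aestronglyMeasurable]
    constructor
    · refine (ae_restrict_iff' measurableSet_Ioo).2 (Filter.Eventually.of_forall fun s hs => ?_)
      exact (integrableOn_rpow_neg_mul_exp hγ (sub_pos.2 hs.2)).mul_const (f s)
    · have h : IntegrableOn (fun s => Real.Gamma (1 - γ) * ((t - s) ^ (γ - 1) * |f s|))
          (Set.Ioo 0 t) :=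
        (((intervalIntegrable_iff_integrableOn_Ioo_of_le ht).1
          ((intervalIntegrable_sub_rpow hγ0).mul_continuousOn hf.abs.continuousOn))).const_mul _
      refine IntegrableOn.congr_fun h (fun s hs => ?_) measurableSet_Ioo
      simp only [Function.uncurry_apply_pair]
      rw [← mul_assoc, ← integral_rpow_neg_mul_exp hγ (sub_pos.2 hs.2), ← integral_mul_const]
      refine setIntegral_congr_fun measurableSet_Ioi fun r hr => ?_
      have hr0 : 0 < r := hr
      simp only [norm_mul, Real.norm_eq_abs, abs_of_pos (Real.rpow_pos_of_pos hr0 _), Real.abs_exp]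
  have hswap := integral_integral_swap hint
  calc Real.Gamma (1 - γ) * ∫ s in (0 : ℝ)..t, (t - s) ^ (γ - 1) * f s
      = ∫ s in Set.Ioo 0 t, ∫ r in Set.Ioi (0 : ℝ),
          r ^ (-γ) * Real.exp (-((t - s) * r)) * f s := by
        rw [← intervalIntegral.integral_const_mul, intervalIntegral.integral_of_le ht,
          integral_Ioc_eq_integral_Ioo]
        refine setIntegral_congr_fun measurableSet_Ioo fun s hs => ?_
        simp only [integral_mul_const]
        rw [integral_rpow_neg_mul_exp hγ (sub_pos.2 hs.2), mul_assoc]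
    _ = _ := hswap
    _ = _ := by
        refine setIntegral_congr_fun measurableSet_Ioi fun r hr => ?_
        simp only [expConvolution]
        rw [← integral_Ioc_eq_integral_Ioo, ← intervalIntegral.integral_of_le ht, ← mul_assoc,
          ← intervalIntegral.integral_const_mul]
        congr 1
        ext s
        rw [show -((t - s) * r) = -(r * t) + r * s by ring, Real.exp_add]
        ring

/-- The Riemann–Liouville kernel of order `γ ∈ (0, 1)` is of positive type. -/
theorem integral_mul_integral_sub_rpow_nonneg {f : ℝ → ℝ} (hf : Continuous f) {γ T : ℝ}
    (hγ0 : 0 < γ) (hγ : γ < 1) (hT : 0 ≤ T) :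
    0 ≤ ∫ t in (0 : ℝ)..T, f t * ∫ s in (0 : ℝ)..t, (t - s) ^ (γ - 1) * f s := by
  obtain ⟨M, hM⟩ := isCompact_Icc.exists_bound_of_continuousOn (s := Set.Icc 0 T) hf.continuousOn
  simp only [Real.norm_eq_abs] at hM
  have hG := Real.Gamma_pos_of_pos (sub_pos.2 hγ)
  have hint : Integrable
      (Function.uncurry fun t r : ℝ => f t * (r ^ (-γ) * expConvolution f r t))
      ((volume.restrict (Set.uIoc 0 T)).prod (volume.restrict (Set.Ioi 0))) := by
    have hmeas : Measurable
        (Function.uncurry fun t r : ℝ => f t * (r ^ (-γ) * expConvolution f r t)) := by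
      simp only [Function.uncurry_def]
      have := hf.measurable
      have := (continuous_expConvolution hf).measurable
      fun_prop
    have : IsFiniteMeasure (volume.restrict (Set.uIoc 0 T)) := ⟨by simp [Set.uIoc]⟩
    have hdom : Integrable (fun p : ℝ × ℝ => (M * M) * (p.2 ^ (-γ) * min T p.2⁻¹))
        ((volume.restrict (Set.uIoc 0 T)).prod (volume.restrict (Set.Ioi 0))) :=
      (integrable_const (M * M)).mul_prod (integrableOn_rpow_neg_mul_min hγ0 hγ hT)
    refine hdom.mono' hmeas.aestronglyMeasurable ?_
    rw [Measure.prod_restrict]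
    refine (ae_restrict_iff' (measurableSet_uIoc.prod measurableSet_Ioi)).2
      (Filter.Eventually.of_forall fun p hp => ?_)
    rw [Set.uIoc_of_le hT] at hp
    obtain ⟨⟨h1, h2⟩, h3⟩ := hp
    have h3 : 0 < p.2 := h3
    have hft := hM p.1 ⟨h1.le, h2⟩
    have hM0 := (abs_nonneg _).trans hft
    have hw := abs_expConvolution_le h3 h1.le h2 fun s hs => hM s ⟨hs.1, hs.2.trans h2⟩
    simp only [Function.uncurry_def, norm_mul, Real.norm_eq_abs]
    rw [abs_of_pos (Real.rpow_pos_of_pos h3 _)]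
    calc |f p.1| * (p.2 ^ (-γ) * |expConvolution f p.2 p.1|)
        ≤ M * (p.2 ^ (-γ) * (M * min T p.2⁻¹)) := by gcongr
      _ = _ := by ring
  have hswap := intervalIntegral_integral_swap hint
  have heq : Real.Gamma (1 - γ) *
      ∫ t in (0 : ℝ)..T, f t * ∫ s in (0 : ℝ)..t, (t - s) ^ (γ - 1) * f s =
      ∫ t in (0 : ℝ)..T, ∫ r in Set.Ioi (0 : ℝ), f t * (r ^ (-γ) * expConvolution f r t) := by
    rw [← intervalIntegral.integral_const_mul]
    refine intervalIntegral.integral_congr fun t ht => ?_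
    rw [Set.uIcc_of_le hT] at ht
    simp only [integral_const_mul]
    rw [← integral_sub_rpow_mul_eq hf hγ0 hγ ht.1]
    ring
  have hnn : 0 ≤ ∫ r in Set.Ioi (0 : ℝ), ∫ t in (0 : ℝ)..T,
      f t * (r ^ (-γ) * expConvolution f r t) := by
    refine setIntegral_nonneg measurableSet_Ioi fun r hr => ?_
    have hr0 : 0 < r := hr
    simp_rw [mul_left_comm (f _), intervalIntegral.integral_const_mul]
    exact mul_nonneg (by positivity) (integral_mul_expConvolution_nonneg hf hr0.le hT)
  rw [← hswap, ← heq] at hnn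
  exact nonneg_of_mul_nonneg_right hnn hG

theorem integral_relaxation {α β t : ℝ} (hα : 1 ≤ α) (hβ : 0 < β) (ht : 0 < t) :
    ∫ s in (0 : ℝ)..t, relaxation α β s = relaxation α (β + 1) t := by
  have h := integral_sub_rpow_mul_relaxation hα hβ one_pos ht
  simpa using h

theorem hasDerivAt_relaxation {α β t : ℝ} (hα : 1 ≤ α) (hβ : 0 < β) (ht : 0 < t) :
    HasDerivAt (relaxation α (β + 1)) (relaxation α β t) t := by
  have hc : ContinuousOn (relaxation α β) (Set.Ioi 0) := fun s hs =>
    (continuousAt_relaxation hα hβ hs).continuousWithinAt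
  have h := intervalIntegral.integral_hasDerivAt_right
    (intervalIntegrable_relaxation hα hβ 0 t)
    (hc.stronglyMeasurableAtFilter isOpen_Ioi t ht) (continuousAt_relaxation hα hβ ht)
  refine h.congr_of_eventuallyEq ?_
  filter_upwards [Ioi_mem_nhds ht] with s hs
  exact (integral_relaxation hα hβ hs).symm

theorem hasDerivAt_relaxation_one {α t : ℝ} (hα : 1 ≤ α) (ht : 0 < t) :
    HasDerivAt (relaxation α 1) (-relaxation α α t) t := by
  have h := (hasDerivAt_relaxation hα (by linarith : 0 < α) ht).const_sub 1
  refine h.congr_of_eventuallyEq ?_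
  filter_upwards [Ioi_mem_nhds ht] with s hs
  rw [relaxation_eq_sub hα one_pos hs, add_comm α 1]
  simp

theorem relaxation_one_zero {α : ℝ} (hα : 1 ≤ α) : relaxation α 1 0 = 1 := by
  rw [relaxation, Real.zero_rpow (by linarith : α ≠ 0), mittagLefflerNeg_zero]
  simp

theorem relaxation_zero {α β : ℝ} (hβ : 1 < β) : relaxation α β 0 = 0 := by
  rw [relaxation, Real.zero_rpow (by linarith), zero_mul]

theorem integral_relaxation_mul_nonneg {α β T : ℝ} (hα1 : 1 < α) (hα2 : α < 2) (hβ : 1 ≤ β)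
    (hT : 0 ≤ T) :
    0 ≤ ∫ t in (0 : ℝ)..T, relaxation α β t * relaxation α (β + (α - 1)) t := by
  have hG := Real.Gamma_pos_of_pos (sub_pos.2 hα1)
  have h := integral_mul_integral_sub_rpow_nonneg (continuous_relaxation hα1.le hβ)
    (sub_pos.2 hα1) (by linarith : α - 1 < 1) hT
  have heq : ∫ t in (0 : ℝ)..T, relaxation α β t *
      ∫ s in (0 : ℝ)..t, (t - s) ^ (α - 1 - 1) * relaxation α β s =
      ∫ t in (0 : ℝ)..T, Real.Gamma (α - 1) *
        (relaxation α β t * relaxation α (β + (α - 1)) t) := by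
    refine intervalIntegral.integral_congr fun t ht => ?_
    rw [Set.uIcc_of_le hT] at ht
    rcases ht.1.eq_or_lt with rfl | ht0
    · simp [relaxation_zero (α := α) (by linarith : 1 < β + (α - 1))]
    · rw [integral_sub_rpow_mul_relaxation hα1.le (by linarith) (sub_pos.2 hα1) ht0]
      ring
  rw [heq, intervalIntegral.integral_const_mul] at h
  exact nonneg_of_mul_nonneg_right h hG

theorem abs_relaxation_one_le {α T : ℝ} (hα1 : 1 < α) (hα2 : α < 2) (hT : 0 ≤ T) :
    |relaxation α 1 T| ≤ 1 := by
  have hu := continuous_relaxation hα1.le le_rfl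
  have hv := continuous_relaxation hα1.le hα1.le
  have h := intervalIntegral.integral_eq_sub_of_hasDerivAt_of_le
    (f := fun t => relaxation α 1 t ^ 2) hT (by fun_prop)
    (fun t ht => (hasDerivAt_relaxation_one hα1.le ht.1).fun_pow 2)
    (Continuous.intervalIntegrable (by fun_prop) _ _)
  have hnn := integral_relaxation_mul_nonneg hα1 hα2 le_rfl hT
  have heq : ∫ t in (0 : ℝ)..T, ((2 : ℕ) : ℝ) * relaxation α 1 t ^ (2 - 1) * -relaxation α α t =
      -2 * ∫ t in (0 : ℝ)..T, relaxation α 1 t * relaxation α (1 + (α - 1)) t := by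
    rw [← intervalIntegral.integral_const_mul, add_sub_cancel]
    congr 1
    ext t
    push_cast
    ring
  rw [heq, relaxation_one_zero hα1.le] at h
  rw [← sq_le_one_iff_abs_le_one]
  linarith

theorem relaxation_self_sq_le {α T : ℝ} (hα1 : 1 < α) (hα2 : α < 2) (hT : 0 ≤ T) :
    relaxation α α T ^ 2 ≤
      2 / Real.Gamma (α - 1) * ∫ t in (0 : ℝ)..T, t ^ (α - 1 - 1) * relaxation α α t := by
  have hα0 : 0 < α - 1 := sub_pos.2 hα1
  have hv := continuous_relaxation hα1.le hα1.le
  have hw := continuous_relaxation hα1.le (by linarith : 1 ≤ α + (α - 1))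
  have hderiv : ∀ t ∈ Set.Ioo 0 T,
      HasDerivAt (relaxation α α) (relaxation α (α - 1) t) t := by
    intro t ht
    have := hasDerivAt_relaxation hα1.le hα0 ht.1
    rwa [sub_add_cancel] at this
  have h := intervalIntegral.integral_eq_sub_of_hasDerivAt_of_le
    (f := fun t => relaxation α α t ^ 2) hT (by fun_prop)
    (fun t ht => (hderiv t ht).fun_pow 2)
    ((intervalIntegrable_relaxation hα1.le hα0 _ _).continuousOn_mul (by fun_prop))
  have hnn := integral_relaxation_mul_nonneg hα1 hα2 hα1.le hT
  have hgv : IntervalIntegrable (fun t : ℝ => t ^ (α - 1 - 1) * relaxation α α t) volume 0 T :=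
    (intervalIntegral.intervalIntegrable_rpow' (by linarith)).mul_continuousOn hv.continuousOn
  have heq : ∫ t in (0 : ℝ)..T, ((2 : ℕ) : ℝ) * relaxation α α t ^ (2 - 1) *
        relaxation α (α - 1) t =
      (2 / Real.Gamma (α - 1) * ∫ t in (0 : ℝ)..T, t ^ (α - 1 - 1) * relaxation α α t) -
      2 * ∫ t in (0 : ℝ)..T, relaxation α α t * relaxation α (α + (α - 1)) t := by
    rw [← intervalIntegral.integral_const_mul, ← intervalIntegral.integral_const_mul,
      ← intervalIntegral.integral_sub (hgv.const_mul _)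
        (Continuous.intervalIntegrable (by fun_prop) _ _)]
    refine intervalIntegral.integral_congr_ae (Filter.Eventually.of_forall fun t ht => ?_)
    rw [Set.uIoc_of_le hT] at ht
    rw [relaxation_eq_sub hα1.le hα0 ht.1, show α - 1 + α = α + (α - 1) by ring]
    push_cast
    ring
  rw [heq, relaxation_zero hα1] at h
  linarith

theorem integral_rpow_mul_relaxation_le {α T : ℝ} (hα1 : 1 < α) (hα2 : α < 2) (hT : 1 ≤ T) :
    ∫ t in (1 : ℝ)..T, t ^ (α - 1 - 1) * relaxation α α t ≤ 2 := by
  have hu := continuous_relaxation hα1.le le_rfl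
  have hv := continuous_relaxation hα1.le hα1.le
  have hpos : ∀ t ∈ Set.uIcc 1 T, 0 < t := fun t ht => by
    rw [Set.uIcc_of_le hT] at ht
    linarith [ht.1]
  have hg' : IntervalIntegrable (fun t : ℝ => (α - 1 - 1) * t ^ (α - 1 - 1 - 1)) volume 1 T :=
    (intervalIntegral.intervalIntegrable_rpow
      (Or.inr fun h => lt_irrefl _ (hpos 0 h))).const_mul _
  have hg : ∀ t ∈ Set.uIcc 1 T, HasDerivAt (fun t : ℝ => t ^ (α - 1 - 1))
      ((α - 1 - 1) * t ^ (α - 1 - 1 - 1)) t := fun t ht =>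
    Real.hasDerivAt_rpow_const (Or.inl (hpos t ht).ne')
  have hparts := intervalIntegral.integral_mul_deriv_eq_deriv_mul hg
    (fun t ht => hasDerivAt_relaxation_one hα1.le (hpos t ht)) hg'
    (Continuous.intervalIntegrable (by fun_prop) _ _)
  have hFTC := intervalIntegral.integral_eq_sub_of_hasDerivAt hg hg'
  have hle : ∫ t in (1 : ℝ)..T, (α - 1 - 1) * t ^ (α - 1 - 1 - 1) * relaxation α 1 t ≤
      ∫ t in (1 : ℝ)..T, -((α - 1 - 1) * t ^ (α - 1 - 1 - 1)) := by
    refine intervalIntegral.integral_mono_on hT (hg'.mul_continuousOn hu.continuousOn) hg'.neg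
      fun t ht => ?_
    have ht0 : 0 < t := by linarith [ht.1]
    have h1 := abs_le.1 (abs_relaxation_one_le hα1 hα2 ht0.le)
    have h2 : 0 ≤ -((α - 1 - 1) * t ^ (α - 1 - 1 - 1)) := by
      have : 0 < t ^ (α - 1 - 1 - 1) := by positivity
      nlinarith
    nlinarith
  rw [intervalIntegral.integral_neg, hFTC] at hle
  simp only [mul_neg, intervalIntegral.integral_neg, Real.one_rpow] at hparts hle
  have hT0 : 0 < T := by linarith
  have hTg : 0 < T ^ (α - 1 - 1) := by positivity
  have h1 := abs_le.1 (abs_relaxation_one_le hα1 hα2 hT0.le)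
  have h2 := abs_le.1 (abs_relaxation_one_le hα1 hα2 zero_le_one)
  nlinarith

theorem exists_abs_relaxation_self_le {α : ℝ} (hα1 : 1 < α) (hα2 : α < 2) :
    ∃ K, ∀ t, 0 ≤ t → |relaxation α α t| ≤ K := by
  have hv := continuous_relaxation hα1.le hα1.le
  obtain ⟨M, hM⟩ := isCompact_Icc.exists_bound_of_continuousOn (s := Set.Icc (0 : ℝ) 1)
    hv.continuousOn
  have hG := Real.Gamma_pos_of_pos (sub_pos.2 hα1)
  have hgv : ∀ a b : ℝ,
      IntervalIntegrable (fun t : ℝ => t ^ (α - 1 - 1) * relaxation α α t) volume a b :=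
    fun a b => (intervalIntegral.intervalIntegrable_rpow' (by linarith)).mul_continuousOn
      hv.continuousOn
  refine ⟨max M (√(2 / Real.Gamma (α - 1) *
    ((∫ t in (0 : ℝ)..1, t ^ (α - 1 - 1) * relaxation α α t) + 2))), fun t ht => ?_⟩
  rcases le_total t 1 with h | h
  · exact le_max_of_le_left (hM t ⟨ht, h⟩)
  · refine le_max_of_le_right (Real.abs_le_sqrt ?_)
    refine (relaxation_self_sq_le hα1 hα2 ht).trans ?_
    rw [← intervalIntegral.integral_add_adjacent_intervals (hgv 0 1) (hgv 1 t)]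
    have := integral_rpow_mul_relaxation_le hα1 hα2 h
    gcongr

theorem abs_mittagLefflerNeg_one_le {α x : ℝ} (hα1 : 1 < α) (hα2 : α < 2) (hx : 0 ≤ x) :
    |mittagLefflerNeg α 1 x| ≤ 1 := by
  have h := abs_relaxation_one_le hα1 hα2 (Real.rpow_nonneg hx α⁻¹)
  rwa [relaxation, Real.rpow_inv_rpow hx (by linarith), sub_self, Real.rpow_zero, one_mul] at h

theorem exists_sq_mittagLefflerNeg_one_sub_one_le {α p : ℝ} (hα1 : 1 < α) (hα2 : α < 2)
    (hp0 : 0 ≤ p) (hp : p ≤ 2) :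
    ∃ K, ∀ x, 0 ≤ x → (mittagLefflerNeg α 1 x - 1) ^ 2 ≤ K * x ^ p := by
  obtain ⟨M, hM⟩ := isCompact_Icc.exists_bound_of_continuousOn (s := Set.Icc (0 : ℝ) 1)
    (continuous_mittagLefflerNeg hα1.le (by linarith : 0 < α + 1)).continuousOn
  refine ⟨max (M ^ 2) 4, fun x hx => ?_⟩
  rcases le_total x 1 with h | h
  · have h1 := hM x ⟨hx, h⟩
    rw [mittagLefflerNeg_eq_sub hα1.le one_pos, Real.Gamma_one]
    have h2 : mittagLefflerNeg α (α + 1) x ^ 2 ≤ M ^ 2 := sq_le_sq' (abs_le.1 h1).1 (abs_le.1 h1).2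
    have h3 : x ^ 2 ≤ x ^ p := by
      rcases hx.eq_or_lt with rfl | hx0
      · rw [zero_pow two_ne_zero]; positivity
      · rw [← Real.rpow_natCast]
        exact Real.rpow_le_rpow_of_exponent_ge hx0 h (by exact_mod_cast hp)
    calc ((1 : ℝ)⁻¹ - x * mittagLefflerNeg α (α + 1) x - 1) ^ 2
        = mittagLefflerNeg α (α + 1) x ^ 2 * x ^ 2 := by ring
      _ ≤ max (M ^ 2) 4 * x ^ p := by
          gcongr
          exact h2.trans (le_max_left _ _)
  · have h1 := abs_le.1 (abs_mittagLefflerNeg_one_le hα1 hα2 hx)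
    calc (mittagLefflerNeg α 1 x - 1) ^ 2 ≤ 4 * 1 := by nlinarith
      _ ≤ max (M ^ 2) 4 * x ^ p := by
          gcongr
          · exact le_max_right _ _
          · exact Real.one_le_rpow h hp0

theorem exists_rpow_mul_sq_mittagLefflerNeg_self_le {α p : ℝ} (hα1 : 1 < α) (hα2 : α < 2)
    (hp0 : 0 ≤ p) (hp : p ≤ 2 - 2 / α) :
    ∃ K, ∀ x, 0 ≤ x → x ^ p * mittagLefflerNeg α α x ^ 2 ≤ K := by
  have hα0 : 0 < α := by linarith
  obtain ⟨M, hM⟩ := isCompact_Icc.exists_bound_of_continuousOn (s := Set.Icc (0 : ℝ) 1)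
    (continuous_mittagLefflerNeg hα1.le hα0).continuousOn
  obtain ⟨L, hL⟩ := exists_abs_relaxation_self_le hα1 hα2
  refine ⟨max (M ^ 2) (L ^ 2), fun x hx => ?_⟩
  rcases le_total x 1 with h | h
  · have h1 := abs_le.1 (hM x ⟨hx, h⟩)
    calc x ^ p * mittagLefflerNeg α α x ^ 2 ≤ 1 * M ^ 2 :=
          mul_le_mul (Real.rpow_le_one hx h hp0) (sq_le_sq' h1.1 h1.2) (sq_nonneg _) zero_le_one
      _ ≤ _ := by rw [one_mul]; exact le_max_left _ _
  · have hx0 : 0 < x := by linarith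
    have h1 := abs_le.1 (hL (x ^ α⁻¹) (by positivity))
    have h2 : relaxation α α (x ^ α⁻¹) ^ 2 = x ^ (2 - 2 / α) * mittagLefflerNeg α α x ^ 2 := by
      rw [relaxation, Real.rpow_inv_rpow hx hα0.ne', mul_pow, ← Real.rpow_natCast,
        ← Real.rpow_mul hx, ← Real.rpow_mul hx]
      congr 2
      push_cast
      field_simp
    calc x ^ p * mittagLefflerNeg α α x ^ 2
        ≤ x ^ (2 - 2 / α) * mittagLefflerNeg α α x ^ 2 := by
          gcongr
      _ ≤ L ^ 2 := by rw [← h2]; exact sq_le_sq' h1.1 h1.2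
      _ ≤ _ := le_max_right _ _

/-- Modewise estimate for the weighted deviation of the velocity from its initial value. -/
theorem exists_velocity_mode_bound {α θ : ℝ} (hα1 : 1 < α) (hα2 : α < 2)
    (hθ1 : (2 - α) / (2 * α) < θ) (hθ2 : θ ≤ 1 / 2) :
    ∃ K, 0 ≤ K ∧ ∀ l a b t : ℝ, 0 < l → 0 ≤ t →
      l ^ (-(2 * θ)) * (-(l * a * t ^ (α - 1)) * mittagLefflerNeg α α (l * t ^ α) +
        b * (mittagLefflerNeg α 1 (l * t ^ α) - 1)) ^ 2 ≤
      K * (t ^ (α - 2 + 2 * α * θ) * (l * a ^ 2) + t ^ (2 * α * θ) * b ^ 2) := by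
  have hα0 : 0 < α := by linarith
  have hθ0 : 0 < θ := lt_trans (by apply div_pos <;> linarith) hθ1
  have hp : 1 - 2 * θ ≤ 2 - 2 / α := by
    have h : (2 - α) / (2 * α) = 1 / α - 1 / 2 := by field_simp
    have h' : 2 / α = 2 * (1 / α) := by ring
    rw [h] at hθ1
    linarith
  obtain ⟨K₁, hK₁⟩ := exists_rpow_mul_sq_mittagLefflerNeg_self_le hα1 hα2
    (by linarith : 0 ≤ 1 - 2 * θ) hp
  obtain ⟨K₂, hK₂⟩ := exists_sq_mittagLefflerNeg_one_sub_one_le hα1 hα2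
    (by linarith : 0 ≤ 2 * θ) (by linarith)
  refine ⟨2 * max 0 (max K₁ K₂), by positivity, fun l a b t hl ht => ?_⟩
  have hK₁' : K₁ ≤ max 0 (max K₁ K₂) := le_max_of_le_right (le_max_left _ _)
  have hK₂' : K₂ ≤ max 0 (max K₁ K₂) := le_max_of_le_right (le_max_right _ _)
  set K := max 0 (max K₁ K₂)
  have hx : 0 ≤ l * t ^ α := by positivity
  have hK0 : 0 ≤ K := le_max_left _ _
  have hA : l ^ (-(2 * θ)) * (-(l * a * t ^ (α - 1)) * mittagLefflerNeg α α (l * t ^ α)) ^ 2 ≤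
      K * (t ^ (α - 2 + 2 * α * θ) * (l * a ^ 2)) := by
    rcases ht.eq_or_lt with rfl | ht0
    · rw [Real.zero_rpow (by linarith : α - 1 ≠ 0)]
      simp only [mul_zero, neg_zero, zero_mul, ne_eq, OfNat.ofNat_ne_zero, not_false_eq_true,
        zero_pow]
      positivity
    · have h1 : l ^ (-(2 * θ)) * l = l ^ (1 - 2 * θ) := by
        rw [← Real.rpow_add_one hl.ne']
        ring_nf
      have h2 : (t ^ (α - 1)) ^ 2 = (t ^ α) ^ (1 - 2 * θ) * t ^ (α - 2 + 2 * α * θ) := by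
        rw [← Real.rpow_natCast, ← Real.rpow_mul ht, ← Real.rpow_mul ht, ← Real.rpow_add ht0]
        congr 1
        push_cast
        ring
      calc l ^ (-(2 * θ)) * (-(l * a * t ^ (α - 1)) * mittagLefflerNeg α α (l * t ^ α)) ^ 2
          = (l ^ (-(2 * θ)) * l) * (t ^ (α - 1)) ^ 2 * mittagLefflerNeg α α (l * t ^ α) ^ 2 *
              (l * a ^ 2) := by ring
        _ = ((l * t ^ α) ^ (1 - 2 * θ) * mittagLefflerNeg α α (l * t ^ α) ^ 2) *
              (t ^ (α - 2 + 2 * α * θ) * (l * a ^ 2)) := by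
            rw [h1, h2, Real.mul_rpow hl.le (by positivity)]
            ring
        _ ≤ _ := by
            gcongr
            exact (hK₁ _ hx).trans hK₁'
  have hB : l ^ (-(2 * θ)) * (b * (mittagLefflerNeg α 1 (l * t ^ α) - 1)) ^ 2 ≤
      K * (t ^ (2 * α * θ) * b ^ 2) := by
    have h1 : l ^ (-(2 * θ)) * (l * t ^ α) ^ (2 * θ) = t ^ (2 * α * θ) := by
      rw [Real.mul_rpow hl.le (by positivity), ← mul_assoc, ← Real.rpow_add hl, neg_add_cancel,
        Real.rpow_zero, one_mul, ← Real.rpow_mul ht]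
      ring_nf
    calc l ^ (-(2 * θ)) * (b * (mittagLefflerNeg α 1 (l * t ^ α) - 1)) ^ 2
        = l ^ (-(2 * θ)) * b ^ 2 * (mittagLefflerNeg α 1 (l * t ^ α) - 1) ^ 2 := by ring
      _ ≤ l ^ (-(2 * θ)) * b ^ 2 * (K * (l * t ^ α) ^ (2 * θ)) := by
          have := hK₂ _ hx
          gcongr
          exact this.trans (by gcongr)
      _ = K * ((l ^ (-(2 * θ)) * (l * t ^ α) ^ (2 * θ)) * b ^ 2) := by ring
      _ = _ := by rw [h1]
  have hl0 : 0 ≤ l ^ (-(2 * θ)) := by positivity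
  nlinarith [mul_le_mul_of_nonneg_left (add_sq_le
    (a := -(l * a * t ^ (α - 1)) * mittagLefflerNeg α α (l * t ^ α))
    (b := b * (mittagLefflerNeg α 1 (l * t ^ α) - 1))) hl0]

end

/-- Spectral-coefficient form of `∂_t u ∈ C([0,T];D(A^{-θ}))` with
`∂_t u(t,·) → u₁` in `D(A^{-θ})` as `t → 0⁺`, for `θ ∈ ((2-α)/(2α), 1/2]`,
`u₀ ∈ H¹₀(Ω)` and `u₁ ∈ L²(Ω)`. -/
theorem velocity_continuity_Dminus_theta (α T θ : ℝ) (hα1 : 1 < α) (hα2 : α < 2)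
    (hT : 0 < T) (hθ1 : (2 - α) / (2 * α) < θ) (hθ2 : θ ≤ 1 / 2)
    (lam a b : ℕ → ℝ) (hlam : ∀ n, 0 < lam n)
    (ha : Summable (fun n => lam n * (a n) ^ 2))
    (hb : Summable (fun n => (b n) ^ 2)) :
    Tendsto (fun t : ℝ => ∑' n : ℕ, (lam n) ^ (-(2 * θ)) *
        ‖((-(lam n * a n * t ^ (α - 1)) : ℝ) : ℂ) *
            mittagLeffler α α ((-(lam n * t ^ α) : ℝ) : ℂ)
          + ((b n : ℝ) : ℂ) * (mittagLeffler α 1 ((-(lam n * t ^ α) : ℝ) : ℂ) - 1)‖ ^ 2)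
      (nhdsWithin 0 (Set.Ioi 0)) (nhds 0)
    ∧
    ∃ C : ℝ, 0 < C ∧ ∀ t ∈ Set.Icc (0 : ℝ) T,
      ∑' n : ℕ, (lam n) ^ (-(2 * θ)) *
        ‖((-(lam n * a n * t ^ (α - 1)) : ℝ) : ℂ) *
            mittagLeffler α α ((-(lam n * t ^ α) : ℝ) : ℂ)
          + ((b n : ℝ) : ℂ) * mittagLeffler α 1 ((-(lam n * t ^ α) : ℝ) : ℂ)‖ ^ 2
      ≤ C * ((∑' n : ℕ, lam n * (a n) ^ 2) + ∑' n : ℕ, (b n) ^ 2) := by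
  have hα0 : 0 < α := by linarith
  have hθ0 : 0 < θ := lt_trans (by apply div_pos <;> linarith) hθ1
  have hq : 0 < α - 2 + 2 * α * θ := by
    rw [div_lt_iff₀ (by linarith)] at hθ1
    linarith
  have hp : 0 < 2 * α * θ := by positivity
  obtain ⟨K, hK0, hK⟩ := exists_velocity_mode_bound hα1 hα2 hθ1 hθ2
  set A := ∑' n : ℕ, lam n * a n ^ 2
  set B := ∑' n : ℕ, b n ^ 2
  have hA0 : 0 ≤ A := tsum_nonneg fun n => mul_nonneg (hlam n).le (sq_nonneg _)
  have hB0 : 0 ≤ B := tsum_nonneg fun n => sq_nonneg _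
  let X : ℝ → ℕ → ℝ := fun t n =>
    -(lam n * a n * t ^ (α - 1)) * mittagLefflerNeg α α (lam n * t ^ α) +
      b n * (mittagLefflerNeg α 1 (lam n * t ^ α) - 1)
  have hw : ∀ n, 0 < lam n ^ (-(2 * θ)) := fun n => Real.rpow_pos_of_pos (hlam n) _
  have hXnn : ∀ t n, 0 ≤ lam n ^ (-(2 * θ)) * X t n ^ 2 := fun t n =>
    mul_nonneg (hw n).le (sq_nonneg _)
  have hmaj : ∀ t : ℝ, HasSum (fun n => K * (t ^ (α - 2 + 2 * α * θ) * (lam n * a n ^ 2) +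
      t ^ (2 * α * θ) * b n ^ 2)) (K * (t ^ (α - 2 + 2 * α * θ) * A + t ^ (2 * α * θ) * B)) :=
    fun t => ((ha.hasSum.mul_left _).add (hb.hasSum.mul_left _)).mul_left K
  have hXsum : ∀ t : ℝ, 0 ≤ t → Summable fun n => lam n ^ (-(2 * θ)) * X t n ^ 2 := fun t ht =>
    Summable.of_nonneg_of_le (hXnn t) (fun n => hK _ _ _ _ (hlam n) ht) (hmaj t).summable
  have hXle : ∀ t : ℝ, 0 ≤ t → ∑' n, lam n ^ (-(2 * θ)) * X t n ^ 2 ≤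
      K * (t ^ (α - 2 + 2 * α * θ) * A + t ^ (2 * α * θ) * B) := fun t ht =>
    hasSum_le (fun n => hK _ _ _ _ (hlam n) ht) (hXsum t ht).hasSum (hmaj t)
  simp_rw [mittagLeffler_ofReal_neg, ← Complex.ofReal_one, ← Complex.ofReal_sub,
    ← Complex.ofReal_mul, ← Complex.ofReal_add, Complex.norm_real, Real.norm_eq_abs, sq_abs]
  constructor
  · refine tendsto_of_tendsto_of_tendsto_of_le_of_le' tendsto_const_nhds
      (h := fun t => K * (t ^ (α - 2 + 2 * α * θ) * A + t ^ (2 * α * θ) * B)) ?_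
      (Filter.Eventually.of_forall fun t => tsum_nonneg (hXnn t)) ?_
    · have h1 := (Real.continuous_rpow_const hq.le).tendsto 0
      have h2 := (Real.continuous_rpow_const hp.le).tendsto 0
      have h := ((h1.mul_const A).add (h2.mul_const B)).const_mul K
      rw [Real.zero_rpow hq.ne', Real.zero_rpow hp.ne'] at h
      simp only [zero_mul, add_zero, mul_zero] at h
      exact h.mono_left nhdsWithin_le_nhds
    · filter_upwards [self_mem_nhdsWithin] with t ht
      exact hXle t (le_of_lt ht)
  · have hY : ∀ t n, -(lam n * a n * t ^ (α - 1)) * mittagLefflerNeg α α (lam n * t ^ α) +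
        b n * mittagLefflerNeg α 1 (lam n * t ^ α) = X t n + b n := fun t n => by
      simp only [X]
      ring
    simp_rw [hY]
    by_cases hs : Summable fun n => lam n ^ (-(2 * θ)) * b n ^ 2
    · set N := ∑' n, lam n ^ (-(2 * θ)) * b n ^ 2
      have hN0 : 0 ≤ N := tsum_nonneg fun n => mul_nonneg (hw n).le (sq_nonneg _)
      have hN : N ≤ N / B * B := by
        rcases hB0.eq_or_lt with h | h
        · have hb0 : ∀ n, b n ^ 2 = 0 := by
            have h' := (hasSum_zero_iff_of_nonneg fun n => sq_nonneg (b n)).1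
              (by simpa only [B, ← h] using hb.hasSum)
            exact fun n => congrFun h' n
          simp [N, hb0]
        · rw [div_mul_cancel₀ _ h.ne']
      set P := T ^ (α - 2 + 2 * α * θ)
      set Q := T ^ (2 * α * θ)
      have hP : 0 ≤ P := by positivity
      have hQ : 0 ≤ Q := by positivity
      have hNB : 0 ≤ N / B := by positivity
      refine ⟨2 * K * (P + Q) + 2 * (N / B) + 1, by positivity, fun t ht => ?_⟩
      have hdom := ((hXsum t ht.1).mul_left 2).add (hs.mul_left 2)
      have hle : ∀ n, lam n ^ (-(2 * θ)) * (X t n + b n) ^ 2 ≤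
          2 * (lam n ^ (-(2 * θ)) * X t n ^ 2) + 2 * (lam n ^ (-(2 * θ)) * b n ^ 2) := fun n => by
        nlinarith [mul_le_mul_of_nonneg_left (add_sq_le (a := X t n) (b := b n)) (hw n).le]
      have htsum := Summable.tsum_le_tsum hle
        (Summable.of_nonneg_of_le (fun n => mul_nonneg (hw n).le (sq_nonneg _)) hle hdom) hdom
      rw [((hXsum t ht.1).mul_left 2).tsum_add (hs.mul_left 2), tsum_mul_left, tsum_mul_left]
        at htsum
      have hPt : t ^ (α - 2 + 2 * α * θ) ≤ P := Real.rpow_le_rpow ht.1 ht.2 hq.le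
      have hQt : t ^ (2 * α * θ) ≤ Q := Real.rpow_le_rpow ht.1 ht.2 hp.le
      have hX : ∑' n, lam n ^ (-(2 * θ)) * X t n ^ 2 ≤ K * (P * A + Q * B) :=
        (hXle t ht.1).trans (by gcongr)
      have h1 : 0 ≤ K * (P * B) := by positivity
      have h2 : 0 ≤ K * (Q * A) := by positivity
      have h3 : 0 ≤ N / B * A := by positivity
      nlinarith
    · refine ⟨1, one_pos, fun t ht => ?_⟩
      rw [tsum_eq_zero_of_not_summable, one_mul]
      · exact add_nonneg hA0 hB0
      · intro h
        refine hs (Summable.of_nonneg_of_le (fun n => mul_nonneg (hw n).le (sq_nonneg _))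
          (fun n => ?_) ((h.mul_left 2).add ((hXsum t ht.1).mul_left 2)))
        nlinarith [mul_le_mul_of_nonneg_left
          (add_sq_le (a := X t n + b n) (b := -X t n)) (hw n).le]
end
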